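/- Let 𝒜 = {A₁, A₂} and 𝒝 = {B₁, B₂}, where A₁ = diag(2, 1/2), A₂ = diag(3, 1/3), B₁ = diag(1/2, 2), B₂ = diag(1/3, 3) are real 2×2 diagonal matrices. Then η(𝒜,𝒝) ≥ (3/2)^{1/2}; in particular η(𝒜,𝒝) > 1, so μ(𝒜,𝒝) ≠ η(𝒜,𝒝) in general. -/

import Mathlib

open Filter

/-- The product `A_n B_n ⋯ A_1 B_1` of the first `n` pairs of factors of two
sequences of matrices (the pair with index `i`, `1 ≤ i ≤ n`, being `A (i-1) * B (i-1)`). -/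
def prodAB {N M : ℕ} (A : ℕ → Matrix (Fin N) (Fin M) ℝ)
    (B : ℕ → Matrix (Fin M) (Fin N) ℝ) : ℕ → Matrix (Fin N) (Fin N) ℝ
  | 0 => 1
  | n + 1 => (A n * B n) * prodAB A B n

/-- The product `A_n B_n ⋯ A_1 B_1` for collections of matrices indexed by `Fin n`. -/
def prodABFin {N M n : ℕ} (A : Fin n → Matrix (Fin N) (Fin M) ℝ)
    (B : Fin n → Matrix (Fin M) (Fin N) ℝ) : Matrix (Fin N) (Fin N) ℝ :=
  (List.ofFn fun i => A i * B i).reverse.prod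

/-- `μ_n(𝒜,𝒝)`: the max over all choices `A_1,…,A_n ∈ 𝒜` of the min over all
choices `B_1,…,B_n ∈ 𝒝` of `ν (A_n B_n ⋯ A_1 B_1)`, where `ν` is a norm on
`N×N` matrices. -/
noncomputable def muN {N M : ℕ} (𝒜 : Finset (Matrix (Fin N) (Fin M) ℝ))
    (𝒝 : Finset (Matrix (Fin M) (Fin N) ℝ)) (hA : 𝒜.Nonempty) (hB : 𝒝.Nonempty)
    (ν : Matrix (Fin N) (Fin N) ℝ → ℝ) (n : ℕ) : ℝ :=
  haveI : Nonempty {A // A ∈ 𝒜} := ⟨⟨hA.choose, hA.choose_spec⟩⟩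
  haveI : Nonempty {B // B ∈ 𝒝} := ⟨⟨hB.choose, hB.choose_spec⟩⟩
  Finset.univ.sup' Finset.univ_nonempty fun A : Fin n → {A // A ∈ 𝒜} =>
    Finset.univ.inf' Finset.univ_nonempty fun B : Fin n → {B // B ∈ 𝒝} =>
      ν (prodABFin (fun i => (A i : Matrix (Fin N) (Fin M) ℝ))
          (fun i => (B i : Matrix (Fin M) (Fin N) ℝ)))

/-- `η_n(𝒜,𝒝)`: the min over all choices `B_1,…,B_n ∈ 𝒝` of the max over all
choices `A_1,…,A_n ∈ 𝒜` of `ν (A_n B_n ⋯ A_1 B_1)`, where `ν` is a norm on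
`N×N` matrices. -/
noncomputable def etaN {N M : ℕ} (𝒜 : Finset (Matrix (Fin N) (Fin M) ℝ))
    (𝒝 : Finset (Matrix (Fin M) (Fin N) ℝ)) (hA : 𝒜.Nonempty) (hB : 𝒝.Nonempty)
    (ν : Matrix (Fin N) (Fin N) ℝ → ℝ) (n : ℕ) : ℝ :=
  haveI : Nonempty {A // A ∈ 𝒜} := ⟨⟨hA.choose, hA.choose_spec⟩⟩
  haveI : Nonempty {B // B ∈ 𝒝} := ⟨⟨hB.choose, hB.choose_spec⟩⟩
  Finset.univ.inf' Finset.univ_nonempty fun B : Fin n → {B // B ∈ 𝒝} =>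
    Finset.univ.sup' Finset.univ_nonempty fun A : Fin n → {A // A ∈ 𝒜} =>
      ν (prodABFin (fun i => (A i : Matrix (Fin N) (Fin M) ℝ))
          (fun i => (B i : Matrix (Fin M) (Fin N) ℝ)))

/-- The lower minimax joint spectral radius `μ(𝒜,𝒝) = inf_{n ≥ 1} μ_n(𝒜,𝒝)^{1/n}`. -/
noncomputable def muJSR {N M : ℕ} (𝒜 : Finset (Matrix (Fin N) (Fin M) ℝ))
    (𝒝 : Finset (Matrix (Fin M) (Fin N) ℝ)) (hA : 𝒜.Nonempty) (hB : 𝒝.Nonempty)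
    (ν : Matrix (Fin N) (Fin N) ℝ → ℝ) : ℝ :=
  ⨅ n : ℕ, muN 𝒜 𝒝 hA hB ν (n + 1) ^ (1 / ((n : ℝ) + 1))

/-- The upper minimax joint spectral radius `η(𝒜,𝒝) = inf_{n ≥ 1} η_n(𝒜,𝒝)^{1/n}`. -/
noncomputable def etaJSR {N M : ℕ} (𝒜 : Finset (Matrix (Fin N) (Fin M) ℝ))
    (𝒝 : Finset (Matrix (Fin M) (Fin N) ℝ)) (hA : 𝒜.Nonempty) (hB : 𝒝.Nonempty)
    (ν : Matrix (Fin N) (Fin N) ℝ → ℝ) : ℝ :=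
  ⨅ n : ℕ, etaN 𝒜 𝒝 hA hB ν (n + 1) ^ (1 / ((n : ℝ) + 1))

/-- The operator norm on real `2×2` matrices induced by the max-norm
`‖x‖ = max {|x₁|, |x₂|}` on `ℝ²`: it equals the maximal absolute row sum. -/
noncomputable def nuMax (X : Matrix (Fin 2) (Fin 2) ℝ) : ℝ :=
  max (|X 0 0| + |X 0 1|) (|X 1 0| + |X 1 1|)

/-- `𝒜 = {A₁, A₂}` with `A₁ = diag(2, 1/2)`, `A₂ = diag(3, 1/3)`. -/
noncomputable def exA : Finset (Matrix (Fin 2) (Fin 2) ℝ) :=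
  {!![(2 : ℝ), 0; 0, 1/2], !![(3 : ℝ), 0; 0, 1/3]}

/-- `𝒝 = {B₁, B₂}` with `B₁ = diag(1/2, 2)`, `B₂ = diag(1/3, 3)`. -/
noncomputable def exB : Finset (Matrix (Fin 2) (Fin 2) ℝ) :=
  {!![(1 : ℝ)/2, 0; 0, 2], !![(1 : ℝ)/3, 0; 0, 3]}

theorem exA_nonempty : exA.Nonempty := Finset.insert_nonempty _ _

theorem exB_nonempty : exB.Nonempty := Finset.insert_nonempty _ _

/-- The alternating product of diagonal matrices is the diagonal matrix of the products. -/
theorem prodABFin_diagonal {N n : ℕ} (a b : Fin n → Fin N → ℝ) :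
    prodABFin (fun i => Matrix.diagonal (a i)) (fun i => Matrix.diagonal (b i)) =
      Matrix.diagonal (∏ i, a i * b i) := by
  have h : (List.ofFn fun i => Matrix.diagonal (a i) * Matrix.diagonal (b i)) =
      (List.ofFn fun i => a i * b i).map (Matrix.diagonalRingHom (Fin N) ℝ) := by
    rw [List.map_ofFn]
    congr 1
    funext i
    exact Matrix.diagonal_mul_diagonal _ _
  rw [prodABFin, h, ← List.map_reverse, ← map_list_prod, List.prod_reverse, List.prod_ofFn]
  rfl

theorem nuMax_nonneg (X : Matrix (Fin 2) (Fin 2) ℝ) : 0 ≤ nuMax X :=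
  le_max_of_le_left (by positivity)

theorem le_nuMax_diagonal (d : Fin 2 → ℝ) (i : Fin 2) :
    d i ≤ nuMax (Matrix.diagonal d) := by
  fin_cases i
  · exact le_max_of_le_left (by simpa using le_abs_self (d 0))
  · exact le_max_of_le_right (by simpa using le_abs_self (d 1))

theorem nuMax_one : nuMax 1 = 1 := by
  simp [nuMax]

theorem matrix_eq_diagonal (x y : ℝ) : !![x, 0; 0, y] = Matrix.diagonal ![x, y] := by
  ext i j
  fin_cases i <;> fin_cases j <;> rfl

/-- Every element of `exB` is of the form `diag(b⁻¹, b)` with `b > 0`. -/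
theorem exists_eq_diagonal_of_mem_exB {B : Matrix (Fin 2) (Fin 2) ℝ} (hB : B ∈ exB) :
    ∃ b : ℝ, 0 < b ∧ B = Matrix.diagonal ![b⁻¹, b] := by
  simp only [exB, Finset.mem_insert, Finset.mem_singleton, matrix_eq_diagonal, one_div] at hB
  rcases hB with rfl | rfl
  · exact ⟨2, by norm_num, rfl⟩
  · exact ⟨3, by norm_num, rfl⟩

/-- For any choice of the factors from `exB`, one of the constant sequences in `exA` produces
a product whose norm is at least `√((3/2)^n)`. -/
theorem sqrt_le_etaN (n : ℕ) :
    √((3 / 2 : ℝ) ^ n) ≤ etaN exA exB exA_nonempty exB_nonempty nuMax n := by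
  refine Finset.le_inf' _ _ fun B _ => ?_
  choose b hb hBb using fun i => exists_eq_diagonal_of_mem_exB (B i).2
  have hP : 0 < ∏ i, b i := Finset.prod_pos fun i _ => hb i
  have h3 : Matrix.diagonal ![(3 : ℝ), 1 / 3] ∈ exA := by
    simp [exA, matrix_eq_diagonal]
  have h2 : Matrix.diagonal ![(2 : ℝ), 1 / 2] ∈ exA := by
    simp [exA, matrix_eq_diagonal]
  have key : √((3 / 2 : ℝ) ^ n) ≤ 3 ^ n / ∏ i, b i ∨ √((3 / 2 : ℝ) ^ n) ≤ (∏ i, b i) / 2 ^ n := by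
    by_contra! h
    have := mul_lt_mul'' h.1 h.2 (by positivity) (by positivity)
    rw [Real.mul_self_sqrt (by positivity), div_pow] at this
    refine this.ne ?_
    field_simp
  simp only [hBb]
  rcases key with h | h
  · refine Finset.le_sup'_of_le _ (Finset.mem_univ fun _ => ⟨_, h3⟩) ?_
    rw [prodABFin_diagonal]
    refine (h.trans_eq ?_).trans (le_nuMax_diagonal _ 0)
    simp [Finset.prod_apply, Finset.prod_mul_distrib, div_eq_mul_inv]
  · refine Finset.le_sup'_of_le _ (Finset.mem_univ fun _ => ⟨_, h2⟩) ?_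
    rw [prodABFin_diagonal]
    refine (h.trans_eq ?_).trans (le_nuMax_diagonal _ 1)
    simp [Finset.prod_apply, Finset.prod_mul_distrib, div_eq_mul_inv, mul_comm]

theorem sqrt_three_halves_le_etaJSR :
    (3 / 2 : ℝ) ^ ((1 : ℝ) / 2) ≤ etaJSR exA exB exA_nonempty exB_nonempty nuMax := by
  refine le_ciInf fun n => ?_
  refine le_trans (le_of_eq ?_)
    (Real.rpow_le_rpow (Real.sqrt_nonneg _) (sqrt_le_etaN (n + 1)) (by positivity))
  rw [Real.sqrt_eq_rpow, ← Real.rpow_natCast, ← Real.rpow_mul (by positivity),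
    ← Real.rpow_mul (by positivity)]
  congr 1
  push_cast
  field_simp

theorem muN_nonneg {N M : ℕ} (𝒜 : Finset (Matrix (Fin N) (Fin M) ℝ))
    (𝒝 : Finset (Matrix (Fin M) (Fin N) ℝ)) (hA : 𝒜.Nonempty) (hB : 𝒝.Nonempty)
    {ν : Matrix (Fin N) (Fin N) ℝ → ℝ} (hν : ∀ X, 0 ≤ ν X) (n : ℕ) :
    0 ≤ muN 𝒜 𝒝 hA hB ν n :=
  Finset.le_sup'_of_le _ (Finset.mem_univ fun _ => ⟨_, hA.choose_spec⟩)
    (Finset.le_inf' _ _ fun _ _ => hν _)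

theorem exists_mul_eq_one_of_mem_exA {A : Matrix (Fin 2) (Fin 2) ℝ} (hA : A ∈ exA) :
    ∃ B ∈ exB, A * B = 1 := by
  simp only [exA, Finset.mem_insert, Finset.mem_singleton] at hA
  rcases hA with rfl | rfl
  · exact ⟨_, Finset.mem_insert_self _ _, by simp [Matrix.one_fin_two]⟩
  · exact ⟨_, Finset.mem_insert_of_mem (Finset.mem_singleton_self _),
      by simp [Matrix.one_fin_two]⟩

theorem muN_le_one (n : ℕ) : muN exA exB exA_nonempty exB_nonempty nuMax n ≤ 1 := by
  refine Finset.sup'_le _ _ fun A _ => ?_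
  choose B hB hAB using fun i => exists_mul_eq_one_of_mem_exA (A i).2
  refine Finset.inf'_le_of_le _ (Finset.mem_univ fun i => ⟨B i, hB i⟩) ?_
  simp [prodABFin, hAB, nuMax_one]

theorem muJSR_le_one : muJSR exA exB exA_nonempty exB_nonempty nuMax ≤ 1 := by
  have h0 := muN_nonneg exA exB exA_nonempty exB_nonempty nuMax_nonneg
  refine ciInf_le_of_le ⟨0, ?_⟩ 0 (Real.rpow_le_one (h0 _) (muN_le_one _) (by positivity))
  rintro _ ⟨n, rfl⟩
  exact Real.rpow_nonneg (h0 _) _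

/-- For `𝒜 = {diag(2,1/2), diag(3,1/3)}` and
`𝒝 = {diag(1/2,2), diag(1/3,3)}`, the upper minimax joint spectral radius
(computed in the operator norm induced by the max-norm on `ℝ²`) satisfies
`η(𝒜,𝒝) ≥ (3/2)^{1/2}`; in particular `η(𝒜,𝒝) > 1` and
`μ(𝒜,𝒝) ≠ η(𝒜,𝒝)`. -/
theorem etaJSR_example_gt_one :
    ((3 / 2 : ℝ) ^ ((1 : ℝ) / 2) ≤ etaJSR exA exB exA_nonempty exB_nonempty nuMax) ∧
      1 < etaJSR exA exB exA_nonempty exB_nonempty nuMax ∧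
      muJSR exA exB exA_nonempty exB_nonempty nuMax ≠
        etaJSR exA exB exA_nonempty exB_nonempty nuMax := by
  have h : 1 < etaJSR exA exB exA_nonempty exB_nonempty nuMax :=
    (Real.one_lt_rpow (by norm_num) (by norm_num)).trans_le sqrt_three_halves_le_etaJSR
  exact ⟨sqrt_three_halves_le_etaJSR, h, (muJSR_le_one.trans_lt h).ne⟩
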